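/- arXiv:1707.05041 — 5 statements merged into one kernel-verified Lean document; each statement's English description precedes it below -/
import Mathlib

section
/- In the coin system, every state (a, b, d₁, d₂) reachable from the initial state (1, 1, true, false) satisfies |a − b| ≤ 1 (as integers). (This is the invariant of Lemma 1 of the paper: during the Fault Checking sub-algorithm, the sizes of the two segments grown by the two marker particles differ by at most 1.) -/
/-- A state of the coin system: left segment size `a`, right segment size `b`,
direction `d₁` of coin 1, direction `d₂` of coin 2
(`true` = travelling toward the right segment's tail). -/
abbrev CoinState := ℕ × ℕ × Bool × Bool

/-- One step of the coin system: deliver one of the two coins.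
If its direction is `true` the right segment grows and the coin bounces;
if `false` the left segment grows and the coin bounces. -/
inductive CoinStep : CoinState → CoinState → Prop
  | coin1_true  (a b : ℕ) (d₂ : Bool) : CoinStep (a, b, true, d₂) (a, b + 1, false, d₂)
  | coin1_false (a b : ℕ) (d₂ : Bool) : CoinStep (a, b, false, d₂) (a + 1, b, true, d₂)
  | coin2_true  (a b : ℕ) (d₁ : Bool) : CoinStep (a, b, d₁, true) (a, b + 1, d₁, false)
  | coin2_false (a b : ℕ) (d₁ : Bool) : CoinStep (a, b, d₁, false) (a + 1, b, d₁, true)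

/-- A state is reachable if it is related to the initial state `(1, 1, true, false)`
by the reflexive-transitive closure of the step relation. -/
def CoinReachable (s : CoinState) : Prop :=
  Relation.ReflTransGen CoinStep (1, 1, true, false) s

theorem CoinStep.size_balance {s t : CoinState} (h : CoinStep s t)
    (hs : (s.1 : ℤ) - s.2.1 = s.2.2.1.toNat + s.2.2.2.toNat - 1) :
    (t.1 : ℤ) - t.2.1 = t.2.2.1.toNat + t.2.2.2.toNat - 1 := by
  cases h <;> simp at hs ⊢ <;> omega

/-- The size difference of a reachable state is determined by the coin directions. -/
theorem CoinReachable.size_balance {s : CoinState} (h : CoinReachable s) :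
    (s.1 : ℤ) - s.2.1 = s.2.2.1.toNat + s.2.2.2.toNat - 1 := by
  induction h with
  | refl => simp
  | tail _ hstep ih => exact hstep.size_balance ih

/-- Lemma 1: in every reachable state of the coin system the sizes of the two
segments differ by at most 1. -/
theorem coin_segments_differ_by_at_most_one
    (a b : ℕ) (d₁ d₂ : Bool) (h : CoinReachable (a, b, d₁, d₂)) :
    |(a : ℤ) - (b : ℤ)| ≤ 1 := by
  have hbal := h.size_balance
  have h₁ := d₁.toNat_le
  have h₂ := d₂.toNat_le
  simp only at hbal
  rw [abs_le]
  omega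
end

section
/- In the coin system, every state (a, b, d₁, d₂) reachable from the initial state (1, 1, true, false) satisfies the exact invariant (a : ℤ) − b = (if d₂ = true then 1 else 0) − (if d₁ = false then 1 else 0). In particular the difference of the two segment sizes is determined by the current directions of the two coins. -/
/-- A step changes the difference of the segment sizes exactly as it changes the coin directions. -/
theorem CoinStep.sub_eq {s t : CoinState} (h : CoinStep s t)
    (hs : (s.1 : ℤ) - (s.2.1 : ℤ) =
      (if s.2.2.2 = true then (1 : ℤ) else 0) - (if s.2.2.1 = false then (1 : ℤ) else 0)) :
    (t.1 : ℤ) - (t.2.1 : ℤ) =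
      (if t.2.2.2 = true then (1 : ℤ) else 0) - (if t.2.2.1 = false then (1 : ℤ) else 0) := by
  cases h <;> simp at hs ⊢ <;> lia

/-- The invariant on the segment sizes, for a reachable state given as a tuple. -/
theorem CoinReachable.sub_eq {s : CoinState} (h : CoinReachable s) :
    (s.1 : ℤ) - (s.2.1 : ℤ) =
      (if s.2.2.2 = true then (1 : ℤ) else 0) - (if s.2.2.1 = false then (1 : ℤ) else 0) := by
  induction h with
  | refl => simp
  | tail _ hstep ih => exact hstep.sub_eq ih

/-- The exact invariant: in every reachable state, the difference `a - b` of the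
two segment sizes is determined by the current directions of the two coins. -/
theorem coin_exact_invariant
    (a b : ℕ) (d₁ d₂ : Bool) (h : CoinReachable (a, b, d₁, d₂)) :
    (a : ℤ) - (b : ℤ) =
      (if d₂ = true then (1 : ℤ) else 0) - (if d₁ = false then (1 : ℤ) else 0) := by
  exact h.sub_eq
end

section
/- In the coin system, every reachable state (a, b, d₁, d₂) in which a + b is even satisfies a = b. (This is the even case of Theorem 1 of the paper: when the line has an even number n of particles and the two segment tails become adjacent, i.e. a + b = n, the Fault Checking sub-algorithm has divided the line into two segments of equal size, so two leaders are elected.) -/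
/-- The invariant of the coin system: the left segment exceeds the right one by the number of
coins travelling right, minus one. -/
theorem CoinReachable.left_add_one_eq {s : CoinState} (h : CoinReachable s) :
    s.1 + 1 = s.2.1 + s.2.2.1.toNat + s.2.2.2.toNat := by
  induction h with
  | refl => rfl
  | tail _ hstep ih =>
    cases hstep <;> simp only [Bool.toNat_true, Bool.toNat_false] at ih ⊢ <;> omega

/-- Theorem 1, even case: in every reachable state in which `a + b` is even,
the two segments have equal size. -/
theorem coin_even_case
    (a b : ℕ) (d₁ d₂ : Bool) (h : CoinReachable (a, b, d₁, d₂))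
    (heven : Even (a + b)) :
    a = b := by
  have hinv := h.left_add_one_eq
  obtain ⟨k, hk⟩ := heven
  cases d₁ <;> cases d₂ <;> simp only [Bool.toNat_true, Bool.toNat_false] at hinv <;> omega
end

section
/- Suppose that for every maximal run [a, b] of correct positions, the set R of departed positions satisfies R ∩ [a, b] ⊆ {a, a+1, b−1, b}, and moreover neither {a, a+1, a+2} ⊆ R nor {b−2, b−1, b} ⊆ R. Then no gap of size 3 is ever created: for every position i with i + 2 ≤ n − 1, at least one of the three consecutive positions i, i+1, i+2 remains occupied (i.e., lies in F or in C \ R). (This is the combinatorial core of Lemma 2 of the paper: the Explorer Creation sub-algorithm, which only lets a correct particle leave the line if it is the immediate neighbour of a faulty particle or the neighbour of such a neighbour, and never lets three consecutive particles at either end of a run leave, never creates a gap of size 3.) -/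
/-- A position outside `F` is preceded by a stretch avoiding `F` that cannot be extended to the
left. -/
theorem exists_left_end (F : Set ℕ) (m : ℕ) (hm : m ∉ F) :
    ∃ a ≤ m, (∀ i, a ≤ i → i ≤ m → i ∉ F) ∧ (a = 0 ∨ a - 1 ∈ F) := by
  induction m with
  | zero => exact ⟨0, le_rfl, fun i _ hi => by rwa [Nat.le_zero.mp hi], Or.inl rfl⟩
  | succ m ih =>
    by_cases h : m ∈ F
    · exact ⟨m + 1, le_rfl, fun i h₁ h₂ => by rwa [le_antisymm h₂ h₁], Or.inr h⟩
    · obtain ⟨a, ha, hF, hend⟩ := ih h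
      refine ⟨a, by omega, fun i h₁ h₂ => ?_, hend⟩
      rcases Nat.le_succ_iff.mp h₂ with h₃ | rfl
      · exact hF i h₁ h₃
      · exact hm

/-- A position outside `F` on the line `{0, …, n-1}` is followed by a stretch avoiding `F` that
cannot be extended to the right. -/
theorem exists_right_end (F : Set ℕ) {n m : ℕ} (hmn : m < n) (hm : m ∉ F) :
    ∃ b, m ≤ b ∧ b < n ∧ (∀ i, m ≤ i → i ≤ b → i ∉ F) ∧ (b = n - 1 ∨ b + 1 ∈ F) := by
  induction hk : n - 1 - m generalizing m with
  | zero => exact ⟨m, le_rfl, hmn, fun i h₁ h₂ => by rwa [le_antisymm h₂ h₁], by omega⟩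
  | succ k ih =>
    by_cases h : m + 1 ∈ F
    · exact ⟨m, le_rfl, hmn, fun i h₁ h₂ => by rwa [le_antisymm h₂ h₁], Or.inr h⟩
    · obtain ⟨b, hb, hbn, hF, hend⟩ := ih (m := m + 1) (by omega) h (by omega)
      refine ⟨b, by omega, hbn, fun i h₁ h₂ => ?_, hend⟩
      rcases h₁.eq_or_lt with rfl | h₃
      · exact hm
      · exact hF i h₃ h₂


/-- Lemma 2 (combinatorial core): positions `{0, …, n-1}` on a line are initially
all occupied; `F` is the (nonempty) set of faulty positions, `C` the set of correct
positions, and `R ⊆ C` the set of correct particles that leave the line.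
If, for every maximal run `[a, b]` of correct positions, the departed positions of
the run lie in `{a, a+1, b-1, b}` and neither `{a, a+1, a+2}` nor `{b-2, b-1, b}`
entirely departed, then no gap of size 3 is created: among any three consecutive
positions of the line, at least one remains occupied (it is faulty or correct and
not departed). -/
theorem explorer_creation_no_gap_of_size_three
    (n : ℕ) (F C R : Set ℕ)
    (hFsub : F ⊆ Set.Iio n)
    (hFne : F.Nonempty)
    (hC : C = {i | i < n ∧ i ∉ F})
    (hR : R ⊆ C)
    (hruns : ∀ a b : ℕ, a ≤ b → b < n →
      (∀ i, a ≤ i → i ≤ b → i ∈ C) →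
      (a = 0 ∨ a - 1 ∈ F) →
      (b = n - 1 ∨ b + 1 ∈ F) →
      (R ∩ Set.Icc a b ⊆ ({a, a + 1, b - 1, b} : Set ℕ)) ∧
      ¬ (({a, a + 1, a + 2} : Set ℕ) ⊆ R) ∧
      ¬ (({b - 2, b - 1, b} : Set ℕ) ⊆ R))
    (i : ℕ) (hi : i + 2 ≤ n - 1) :
    ∃ j ∈ ({i, i + 1, i + 2} : Set ℕ), j ∈ F ∨ (j ∈ C ∧ j ∉ R) := by
  by_contra! hgap
  have hmem : ∀ j, i ≤ j → j ≤ i + 2 → j ∈ R := by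
    intro j h₁ h₂
    have hj : j ∈ ({i, i + 1, i + 2} : Set ℕ) := by
      simp only [Set.mem_insert_iff, Set.mem_singleton_iff]
      omega
    obtain ⟨hjF, hjR⟩ := hgap j hj
    refine hjR ?_
    rw [hC]
    exact ⟨by omega, hjF⟩
  have hnF : ∀ j ∈ R, j ∉ F := fun j hj => by
    have := hR hj
    rw [hC] at this
    exact this.2
  obtain ⟨a, hai, haF, haend⟩ := exists_left_end F i (hnF i (hmem i le_rfl (by omega)))
  obtain ⟨b, hib, hbn, hbF, hbend⟩ := exists_right_end F (n := n) (m := i + 2) (by omega)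
    (hnF _ (hmem _ (by omega) le_rfl))
  obtain ⟨hsub, hleft, hright⟩ := hruns a b (by omega) hbn (fun j h₁ h₂ => by
    rw [hC]
    refine ⟨by omega, ?_⟩
    rcases le_total j i with h | h
    · exact haF j h₁ h
    · rcases le_total j (i + 2) with h' | h'
      · exact hnF j (hmem j h h')
      · exact hbF j h' h₂) haend hbend
  have hends : ∀ j, i ≤ j → j ≤ i + 2 → j = a ∨ j = a + 1 ∨ j = b - 1 ∨ j = b :=
    fun j h₁ h₂ => hsub ⟨hmem j h₁ h₂, by omega, by omega⟩
  have h₀ := hends i le_rfl (by omega)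
  have h₁ := hends (i + 1) (by omega) (by omega)
  have h₂ := hends (i + 2) (by omega) le_rfl
  have hcase : i = a ∨ i + 2 = b := by omega
  rcases hcase with h | h
  · refine hleft ?_
    rintro j (rfl | rfl | rfl) <;> exact hmem _ (by omega) (by omega)
  · refine hright ?_
    rintro j (rfl | rfl | rfl) <;> exact hmem _ (by omega) (by omega)
end

section
/- Let m be the number of end runs and let E = Σ over interior runs of g(ℓ) + Σ over end runs of h(ℓ), where ℓ denotes the length of the run, g(1) = 1, g(2) = g(3) = g(4) = 2, g(ℓ) = 4 for ℓ ≥ 5, and h(1) = 0, h(2) = 1, h(ℓ) = 2 for ℓ ≥ 3. If the total number of correct positions is at least 5 and F is nonempty, then either m ≥ 1 and E ≥ 2, or E ≥ 3. (This is the counting core of Lemma 3 of the paper: there is a round in which there is either a marker and at least two pre-explorers, or at least three pre-explorers.) -/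
/-- Lower bound on the number of pre-explorers produced by an interior run
of length `ℓ` (a run bounded on both sides by faulty particles). -/
def interiorExplorers : ℕ → ℕ
  | 0 => 0
  | 1 => 1
  | 2 => 2
  | 3 => 2
  | 4 => 2
  | _ => 4

/-- Lower bound on the number of pre-explorers produced by an end run
of length `ℓ` (a run containing an endpoint of the line, whose extreme
particle becomes a marker). -/
def endExplorers : ℕ → ℕ
  | 0 => 0
  | 1 => 0
  | 2 => 1
  | _ => 2

theorem interiorExplorers_of_five_le {l : ℕ} (h : 5 ≤ l) : interiorExplorers l = 4 := by
  obtain ⟨k, rfl⟩ := Nat.exists_eq_add_of_le' h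
  rfl

theorem endExplorers_of_three_le {l : ℕ} (h : 3 ≤ l) : endExplorers l = 2 := by
  obtain ⟨k, rfl⟩ := Nat.exists_eq_add_of_le' h
  rfl

theorem sub_one_le_endExplorers (l : ℕ) : min (l - 1) 2 ≤ endExplorers l := by
  rcases le_or_gt 3 l with h | h
  · rw [endExplorers_of_three_le h]
    exact min_le_right _ _
  · interval_cases l <;> decide

theorem interiorExplorers_sum_bounds (s : Multiset ℕ) :
    min s.sum 2 ≤ (s.map interiorExplorers).sum ∧
      (5 ≤ s.sum → 3 ≤ (s.map interiorExplorers).sum) := by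
  induction s using Multiset.induction with
  | empty => simp
  | cons l s ih =>
    simp only [Multiset.map_cons, Multiset.sum_cons]
    rcases le_or_gt 5 l with h | h
    · rw [interiorExplorers_of_five_le h]
      omega
    · interval_cases l <;> simp only [interiorExplorers] <;> omega

/-- Lemma 3 (counting core): the maximal runs of correct positions are given by the
multisets `interior` and `ends` of their lengths (each run is nonempty, and since
`F ≠ ∅` there are at most two end runs).  Let `m` be the number of end runs (each
contributing a marker) and `E` the total number of pre-explorers guaranteed by the
Explorer Creation sub-algorithm.  If there are at least 5 correct particles, then
either `m ≥ 1` and `E ≥ 2`, or `E ≥ 3`. -/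
theorem marker_and_explorers_count
    (interior ends : Multiset ℕ)
    (hpos_i : ∀ ℓ ∈ interior, 1 ≤ ℓ)
    (hpos_e : ∀ ℓ ∈ ends, 1 ≤ ℓ)
    (hm : Multiset.card ends ≤ 2)
    (htot : 5 ≤ interior.sum + ends.sum) :
    (1 ≤ Multiset.card ends ∧
      2 ≤ (interior.map interiorExplorers).sum + (ends.map endExplorers).sum) ∨
    3 ≤ (interior.map interiorExplorers).sum + (ends.map endExplorers).sum := by
  obtain ⟨h₂, h₅⟩ := interiorExplorers_sum_bounds interior
  have hcard : ends.card = 0 ∨ ends.card = 1 ∨ ends.card = 2 := by omega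
  rcases hcard with h | h | h
  · obtain rfl := Multiset.card_eq_zero.mp h
    simp only [Multiset.sum_zero, Multiset.map_zero] at *
    omega
  · obtain ⟨a, rfl⟩ := Multiset.card_eq_one.mp h
    have ha := sub_one_le_endExplorers a
    simp only [Multiset.sum_singleton, Multiset.map_singleton] at *
    omega
  · obtain ⟨a, b, rfl⟩ := Multiset.card_eq_two.mp h
    have ha := sub_one_le_endExplorers a
    have hb := sub_one_le_endExplorers b
    simp only [Multiset.insert_eq_cons, Multiset.map_cons, Multiset.sum_cons,
      Multiset.sum_singleton, Multiset.map_singleton] at *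
    omega
end
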